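/- For every maximal S-free convex set B such that B ∩ conv(S) has nonempty interior, there exists a maximal lattice-free convex set K such that for every facet F of B, the set F ∩ K is a facet of K. -/

import Mathlib

open scoped BigOperators Pointwise

noncomputable section

/-- Euclidean space `ℝⁿ`. -/
abbrev E (n : ℕ) := EuclideanSpace ℝ (Fin n)

/-- Dot product on `ℝⁿ`. -/
def dot {n : ℕ} (x y : E n) : ℝ := ∑ i, x i * y i

/-- A point with integral coordinates. -/
def IsIntPt {n : ℕ} (x : E n) : Prop := ∀ i, ∃ m : ℤ, x i = (m : ℝ)

/-- A vector with rational coordinates. -/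
def IsRatVec {n : ℕ} (x : E n) : Prop := ∀ i, ∃ q : ℚ, x i = (q : ℝ)

/-- `S` is the set of integral points of a rational polyhedron `{x | Ax ≤ b}`. -/
def IsIntPtsOfRatPolyhedron {n : ℕ} (S : Set (E n)) : Prop :=
  ∃ (m : ℕ) (A : Fin m → E n) (b : Fin m → ℝ),
    (∀ i, IsRatVec (A i)) ∧ (∀ i, ∃ q : ℚ, b i = (q : ℝ)) ∧
    S = {x | IsIntPt x ∧ ∀ i, dot (A i) x ≤ b i}

/-- `dim S = n`: `S` contains `n+1` affinely independent points. -/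
def FullDimSet {n : ℕ} (S : Set (E n)) : Prop :=
  ∃ p : Fin (n + 1) → E n, (∀ i, p i ∈ S) ∧ AffineIndependent ℝ p

/-- `B` is `S`-free: the interior of `B` contains no point of `S`. -/
def SFree {n : ℕ} (S B : Set (E n)) : Prop := ∀ x ∈ interior B, x ∉ S

/-- `B` is a maximal `S`-free convex set. -/
def MaxSFree {n : ℕ} (S B : Set (E n)) : Prop :=
  Convex ℝ B ∧ SFree S B ∧
    ∀ C : Set (E n), Convex ℝ C → SFree S C → B ⊆ C → B = C

/-- `B` is lattice-free: no integral point in its interior. -/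
def LatticeFree {n : ℕ} (B : Set (E n)) : Prop := ∀ x ∈ interior B, ¬ IsIntPt x

/-- `B` is a maximal lattice-free convex set. -/
def MaxLatticeFree {n : ℕ} (B : Set (E n)) : Prop :=
  Convex ℝ B ∧ LatticeFree B ∧
    ∀ C : Set (E n), Convex ℝ C → LatticeFree C → B ⊆ C → B = C

/-- A polyhedron: finite intersection of closed half-spaces. -/
def IsPolyhedron {n : ℕ} (B : Set (E n)) : Prop :=
  ∃ (m : ℕ) (a : Fin m → E n) (c : Fin m → ℝ), B = {x | ∀ i, dot (a i) x ≤ c i}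

/-- A polytope: convex hull of finitely many points. -/
def IsPolytope {n : ℕ} (P : Set (E n)) : Prop :=
  ∃ V : Finset (E n), P = convexHull ℝ (V : Set (E n))

/-- Dimension of a set: dimension of its affine hull. -/
def sdim {n : ℕ} (A : Set (E n)) : ℕ := Module.finrank ℝ (affineSpan ℝ A).direction

/-- `F` is a face of the convex set `B`. -/
def IsFaceOf {n : ℕ} (F B : Set (E n)) : Prop :=
  F ⊆ B ∧ Convex ℝ F ∧ ∀ x ∈ B, ∀ y ∈ B, ∀ t : ℝ, 0 < t → t < 1 →
    t • x + (1 - t) • y ∈ F → x ∈ F ∧ y ∈ F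

/-- `F` is a facet of `B`: a nonempty face of dimension `dim B - 1`. -/
def IsFacetOf {n : ℕ} (F B : Set (E n)) : Prop :=
  IsFaceOf F B ∧ F.Nonempty ∧ sdim F + 1 = sdim B

/-- Recession cone of `K`. -/
def recCone {n : ℕ} (K : Set (E n)) : Set (E n) :=
  {d | ∀ x ∈ K, ∀ t : ℝ, 0 ≤ t → x + t • d ∈ K}

/-- Lineality space of `K`. -/
def linSpace {n : ℕ} (K : Set (E n)) : Set (E n) :=
  {d | d ∈ recCone K ∧ -d ∈ recCone K}

/-- The set of all finite nonnegative combinations of elements of `G`. -/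
def conicHullOf {n : ℕ} (G : Set (E n)) : Set (E n) :=
  {x | ∃ (m : ℕ) (c : Fin m → ℝ) (v : Fin m → E n),
    (∀ i, 0 ≤ c i) ∧ (∀ i, v i ∈ G) ∧ x = ∑ i, c i • v i}

/-- A cone is rational if it is generated by vectors with rational coordinates. -/
def IsRationalCone {n : ℕ} (C : Set (E n)) : Prop :=
  ∃ G : Set (E n), (∀ v ∈ G, IsRatVec v) ∧ C = conicHullOf G

/-- A linear subspace is rational if it is spanned by rational vectors. -/
def IsRationalSubspace {n : ℕ} (L : Submodule ℝ (E n)) : Prop :=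
  ∃ G : Set (E n), (∀ v ∈ G, IsRatVec v) ∧ L = Submodule.span ℝ G

/-- The hyperplane `{x | a·x = β}` is a supporting hyperplane of `C`. -/
def IsSupportingHyperplane {n : ℕ} (a : E n) (β : ℝ) (C : Set (E n)) : Prop :=
  ((∀ x ∈ C, dot a x ≤ β) ∨ (∀ x ∈ C, β ≤ dot a x)) ∧
    ∃ x ∈ closure C, dot a x = β

/-- `ψ` is a valid function with respect to `f` and `S`. -/
def ValidFn {n : ℕ} (S : Set (E n)) (f : E n) (ψ : E n → ℝ) : Prop :=
  ∀ s : (E n) →₀ ℝ, (∀ r, 0 ≤ s r) →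
    (f + s.sum fun r c => c • r) ∈ S →
    1 ≤ s.sum fun r c => ψ r * c

/-- Sublinear: positively homogeneous and subadditive. -/
def Sublinear {n : ℕ} (ψ : E n → ℝ) : Prop :=
  (∀ t : ℝ, 0 ≤ t → ∀ r, ψ (t • r) = t * ψ r) ∧
  (∀ r r', ψ (r + r') ≤ ψ r + ψ r')

/-- Polar of `K`. -/
def polar {n : ℕ} (K : Set (E n)) : Set (E n) := {y | ∀ r ∈ K, dot y r ≤ 1}

/-- `K̂ = {y ∈ K* | ∃ x ∈ K, x·y = 1}`. -/
def Khat {n : ℕ} (K : Set (E n)) : Set (E n) :=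
  {y | y ∈ polar K ∧ ∃ x ∈ K, dot x y = 1}

/-- `ρ_K(r) = sup { y·r | y ∈ K̂ }`. -/
def rho {n : ℕ} (K : Set (E n)) (r : E n) : ℝ :=
  sSup ((fun y => dot y r) '' Khat K)


/-! ### Elementary convexity -/

lemma int_of_extend {n : ℕ} {M : Set (E n)} (hM : Convex ℝ M) {b z : E n}
    (hb : b ∈ interior M) {η : ℝ} (hη : 0 < η) (h : z + η • (z - b) ∈ M) :
    z ∈ interior M := by
  have h1 : (0:ℝ) < 1 + η := by linarith
  have := hM.combo_interior_self_mem_interior hb h (a := η / (1 + η)) (b := 1 / (1 + η))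
    (by positivity) (by positivity) (by field_simp; ring)
  convert this using 1
  ext i
  simp
  field_simp
  ring

lemma extend_mem {n : ℕ} {U : Set (E n)} (hU : IsOpen U) {z : E n} (hz : z ∈ U) (v : E n) :
    ∃ η : ℝ, 0 < η ∧ η < 1 ∧ ∀ t : ℝ, 0 ≤ t → t ≤ η → z + t • v ∈ U := by
  have hc : Continuous (fun t : ℝ => z + t • v) := by fun_prop
  have := (hU.preimage hc).mem_nhds (show (0:ℝ) ∈ _ by simpa using hz)
  obtain ⟨δ, hδ, hb⟩ := Metric.mem_nhds_iff.1 this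
  refine ⟨min (δ / 2) (1 / 2), by positivity, by
    have := min_le_right (δ / 2) (1 / 2 : ℝ); linarith, fun t h0 ht => hb ?_⟩
  have := min_le_left (δ / 2) (1 / 2 : ℝ)
  rw [Metric.mem_ball, Real.dist_eq, sub_zero, abs_of_nonneg h0]
  linarith

lemma lt_of_mem_interior {n : ℕ} {M : Set (E n)} {f : E n →L[ℝ] ℝ} (hf : f ≠ 0) {c : ℝ}
    (hle : ∀ u ∈ M, f u ≤ c) {b : E n} (hb : b ∈ interior M) : f b < c := by
  obtain ⟨v, hv⟩ : ∃ v, f v ≠ 0 := by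
    by_contra! h
    exact hf (by ext v; simp [h v])
  obtain ⟨η, h0, -, h⟩ := extend_mem isOpen_interior hb ((f v) • v)
  have := hle _ (interior_subset (h η h0.le le_rfl))
  simp only [map_add, map_smul, smul_eq_mul] at this
  have : 0 < η * (f v * f v) := mul_pos h0 (mul_self_pos.2 hv)
  linarith

/-- Supporting functional at a non-interior point. -/
lemma exists_support {n : ℕ} {M : Set (E n)} (hM : Convex ℝ M) (hne : (interior M).Nonempty)
    {s : E n} (hs : s ∉ interior M) :
    ∃ f : E n →L[ℝ] ℝ, f ≠ 0 ∧ ∀ u ∈ M, f u ≤ f s := by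
  obtain ⟨f, hf⟩ := geometric_hahn_banach_open_point hM.interior isOpen_interior hs
  refine ⟨f, ?_, ?_⟩
  · rintro rfl
    obtain ⟨b, hb⟩ := hne
    simpa using hf b hb
  · intro u hu
    have hu' : u ∈ closure (interior M) := by
      rw [hM.closure_interior_eq_closure_of_nonempty_interior hne]
      exact subset_closure hu
    have hcl : IsClosed {u | f u ≤ f s} := isClosed_le f.continuous continuous_const
    have hfinal := closure_minimal (fun b hb => (hf b hb).le) hcl hu'
    exact hfinal

/-- Existence of maximal lattice-free sets. -/
lemma exists_maxLatticeFree {n : ℕ} {C : Set (E n)} (hC : Convex ℝ C) (hfree : LatticeFree C)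
    (hne : (interior C).Nonempty) : ∃ K, MaxLatticeFree K ∧ C ⊆ K := by
  obtain ⟨b, hb⟩ := hne
  obtain ⟨K, hCK, hK⟩ := zorn_subset_nonempty {K : Set (E n) | Convex ℝ K ∧ LatticeFree K ∧ C ⊆ K} (by
    intro c hc hchain hcne
    refine ⟨⋃₀ c, ⟨?_, ?_, ?_⟩, fun s hs => Set.subset_sUnion_of_mem hs⟩
    · exact hchain.directedOn.convex_sUnion (fun {s} hs => (hc hs).1)
    · intro z hz hint
      obtain ⟨η, h0, -, h⟩ := extend_mem isOpen_interior hz (z - b)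
      obtain ⟨M, hMc, hM⟩ := interior_subset (h η h0.le le_rfl)
      have hm := hc hMc
      exact hm.2.1 z (int_of_extend hm.1 (interior_mono hm.2.2 hb) h0 hM) hint
    · obtain ⟨s, hs⟩ := hcne
      exact (hc hs).2.2.trans (Set.subset_sUnion_of_mem hs)) C ⟨hC, hfree, subset_rfl⟩
  refine ⟨K, ⟨hK.prop.1, hK.prop.2.1, ?_⟩, hCK⟩
  intro D hD hDf hKD
  exact hK.eq_of_subset ⟨hD, hDf, hCK.trans hKD⟩ hKD

/-! ### Maximality -/

lemma MaxSFree.isClosed {n : ℕ} {S B : Set (E n)} (hB : MaxSFree S B)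
    (hne : (interior B).Nonempty) : IsClosed B := by
  have : B = closure B := hB.2.2 _ hB.1.closure (by
    intro x hx
    rw [hB.1.interior_closure_eq_interior_of_nonempty_interior hne] at hx
    exact hB.2.1 x hx) subset_closure
  rw [this]; exact isClosed_closure

lemma MaxSFree.absorb {n : ℕ} {S B : Set (E n)} (hB : MaxSFree S B)
    (hne : (interior B).Nonempty) {U : Set (E n)} (hU : IsOpen U) (hUc : Convex ℝ U)
    (hBU : interior B ⊆ U) (hUS : ∀ x ∈ U, x ∉ S) : U ⊆ B := by
  have hUne : (interior U).Nonempty := by rw [hU.interior_eq]; exact hne.mono hBU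
  have : B = closure U := hB.2.2 _ hUc.closure (by
    intro x hx
    rw [hUc.interior_closure_eq_interior_of_nonempty_interior hUne, hU.interior_eq] at hx
    exact hUS x hx) (by
      calc B ⊆ closure B := subset_closure
        _ = closure (interior B) :=
          (hB.1.closure_interior_eq_closure_of_nonempty_interior hne).symm
        _ ⊆ closure U := closure_mono hBU)
  rw [this]; exact subset_closure

/-- integrality -/
lemma isIntPt_add {n : ℕ} {x y : E n} (hx : IsIntPt x) (hy : IsIntPt y) : IsIntPt (x + y) := by
  intro i
  obtain ⟨a, ha⟩ := hx i
  obtain ⟨b, hb⟩ := hy i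
  exact ⟨a + b, by simp [ha, hb]⟩

lemma isIntPt_zsmul {n : ℕ} {x : E n} (k : ℤ) (hx : IsIntPt x) : IsIntPt ((k : ℝ) • x) := by
  intro i
  obtain ⟨a, ha⟩ := hx i
  exact ⟨k * a, by simp [ha]⟩

lemma isIntPt_sub {n : ℕ} {x y : E n} (hx : IsIntPt x) (hy : IsIntPt y) : IsIntPt (x - y) := by
  intro i
  obtain ⟨a, ha⟩ := hx i
  obtain ⟨b, hb⟩ := hy i
  exact ⟨a - b, by simp [ha, hb]⟩

/-- In a bounded sequence two terms (with given gap order) are arbitrarily close. -/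
lemma exists_close {n : ℕ} (x : ℕ → E n) {R : ℝ} (hR : ∀ k, ‖x k‖ ≤ R) {ε : ℝ} (hε : 0 < ε) :
    ∃ j k, j < k ∧ ‖x k - x j‖ < ε := by
  obtain ⟨a, -, φ, hφ, hlim⟩ := tendsto_subseq_of_bounded
    (Metric.isBounded_closedBall (x := (0 : E n)) (r := R)) (x := x)
    (fun k => by simpa using hR k)
  have hc := hlim.cauchySeq
  obtain ⟨N, hN⟩ := Metric.cauchySeq_iff.1 hc ε hε
  refine ⟨φ N, φ (N + 1), hφ (Nat.lt_succ_self N), ?_⟩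
  have := hN (N + 1) (Nat.le_succ N) N le_rfl
  rwa [dist_eq_norm] at this

/-- Dirichlet approximation. -/
lemma dirichlet {n : ℕ} (r : E n) {ε : ℝ} (hε : 0 < ε) (T : ℝ) :
    ∃ t : ℝ, T ≤ t ∧ 0 ≤ t ∧ ∃ z : E n, IsIntPt z ∧ ‖z - t • r‖ < ε := by
  set T' := max T 0
  let fl : ℕ → E n := fun k => WithLp.toLp 2 (fun i => ((⌊(k * T') * r i⌋ : ℤ) : ℝ))
  let x : ℕ → E n := fun k => ((k : ℝ) * T') • r - fl k
  have hfl : ∀ k, IsIntPt (fl k) := fun k i => ⟨_, rfl⟩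
  have hx : ∀ k, ‖x k‖ ≤ Real.sqrt n := by
    intro k
    rw [EuclideanSpace.norm_eq]
    apply Real.sqrt_le_sqrt
    calc ∑ i, ‖x k i‖ ^ 2 ≤ ∑ i : Fin n, (1:ℝ) := by
          apply Finset.sum_le_sum
          intro i _
          have : x k i = Int.fract ((k * T') * r i) := by
            simp [x, fl]
          rw [this, Real.norm_of_nonneg (Int.fract_nonneg _)]
          have h1 := Int.fract_nonneg ((k * T') * r i)
          have h2 := (Int.fract_lt_one ((k * T') * r i)).le
          nlinarith
      _ = n := by simp
  obtain ⟨j, k, hjk, h⟩ := exists_close x hx hε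
  have hT' : 0 ≤ T' := le_max_right _ _
  have hkj : (1:ℝ) ≤ (k:ℝ) - j := by
    have : (j:ℝ) + 1 ≤ k := by exact_mod_cast hjk
    linarith
  refine ⟨((k:ℝ) - j) * T', ?_, by nlinarith, fl k - fl j, isIntPt_sub (hfl k) (hfl j), ?_⟩
  · have : T ≤ T' := le_max_left _ _
    nlinarith
  · have : fl k - fl j - (((k:ℝ) - j) * T') • r = -(x k - x j) := by
      simp only [x, sub_mul, sub_smul]
      abel
    rw [this, norm_neg]
    exact h

/-- recession directions of closed sets -/
lemma recCone_add {n : ℕ} {B : Set (E n)} {u v : E n} (hu : u ∈ recCone B) (hv : v ∈ recCone B) :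
    u + v ∈ recCone B := by
  intro x hx t ht
  have := hv _ (hu x hx t ht) t ht
  rwa [add_assoc, ← smul_add] at this

lemma recCone_smul {n : ℕ} {B : Set (E n)} {u : E n} (hu : u ∈ recCone B) {c : ℝ} (hc : 0 ≤ c) :
    c • u ∈ recCone B := by
  intro x hx t ht
  have := hu x hx (t * c) (mul_nonneg ht hc)
  rwa [mul_smul] at this

lemma recCone_zero {n : ℕ} {B : Set (E n)} : (0 : E n) ∈ recCone B := by
  intro x hx t ht
  simpa using hx

lemma recCone_interior {n : ℕ} {B : Set (E n)} {u b : E n} (hu : u ∈ recCone B)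
    (hb : b ∈ interior B) : b + u ∈ interior B := by
  rw [mem_interior]
  refine ⟨(fun x => x + u) '' interior B, ?_, (isOpenMap_add_right u) _ isOpen_interior,
    ⟨b, hb, rfl⟩⟩
  rintro _ ⟨x, hx, rfl⟩
  simpa using hu x (interior_subset hx) 1 zero_le_one

/-- limits of normalised unbounded sequences are recession directions -/
lemma recCone_of_tendsto {n : ℕ} {B : Set (E n)} (hB : Convex ℝ B) (hcl : IsClosed B)
    {b : ℕ → E n} (hb : ∀ k, b k ∈ B) {c : ℕ → ℝ} (hc : ∀ k, 0 < c k)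
    (hc0 : Filter.Tendsto c Filter.atTop (nhds 0)) {w : E n}
    (hw : Filter.Tendsto (fun k => c k • b k) Filter.atTop (nhds w)) : w ∈ recCone B := by
  intro x hx t ht
  have hlim : Filter.Tendsto (fun k => (1 - t * c k) • x + t • (c k • b k)) Filter.atTop
      (nhds ((1 - t * 0) • x + t • w)) :=
    ((tendsto_const_nhds.sub (hc0.const_mul t)).smul_const x).add (hw.const_smul t)
  have hx' : (1 - t * 0) • x + t • w = x + t • w := by simp
  rw [hx'] at hlim
  refine hcl.mem_of_tendsto hlim ?_
  have h1 : Filter.Tendsto (fun k => t * c k) Filter.atTop (nhds (t * 0)) := hc0.const_mul t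
  rw [mul_zero] at h1
  filter_upwards [h1.eventually (gt_mem_nhds (show (0:ℝ) < 1 by norm_num))] with k hk
  rw [← mul_smul]
  exact hB hx (hb k) (by linarith) (mul_nonneg ht (hc k).le) (by ring)

/-! ### The core setting -/

structure Ctx {n m : ℕ} (S B : Set (E n)) (α : Fin m → (E n →L[ℝ] ℝ)) (β : Fin m → ℤ) : Prop where
  hS : ∀ x, x ∈ S ↔ IsIntPt x ∧ ∀ i, α i x ≤ β i
  hα : ∀ i z, IsIntPt z → ∃ k : ℤ, α i z = k
  hB : MaxSFree S B
  hne : (interior B).Nonempty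

lemma exists_small {n m : ℕ} (α : Fin m → (E n →L[ℝ] ℝ)) {c : ℝ} (hc : 0 < c) :
    ∃ δ : ℝ, 0 < δ ∧ ∀ v : E n, ‖v‖ < δ → ∀ i, |α i v| < c := by
  have : ∀ᶠ v in nhds (0 : E n), ∀ i, |α i v| < c := by
    rw [Filter.eventually_all]
    intro i
    have h : Filter.Tendsto (fun v => |α i v|) (nhds 0) (nhds |α i 0|) :=
      ((α i).continuous.abs).tendsto 0
    rw [map_zero, abs_zero] at h
    exact h.eventually (gt_mem_nhds hc)
  obtain ⟨δ, hδ, h⟩ := Metric.eventually_nhds_iff.1 this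
  exact ⟨δ, hδ, fun v hv => h (by simpa using hv)⟩

lemma Ctx.closed {n m : ℕ} {S B : Set (E n)} {α : Fin m → (E n →L[ℝ] ℝ)} {β : Fin m → ℤ}
    (h : Ctx S B α β) : IsClosed B := h.hB.isClosed h.hne

lemma Ctx.mem_of_lt {n m : ℕ} {S B : Set (E n)} {α : Fin m → (E n →L[ℝ] ℝ)} {β : Fin m → ℤ}
    (h : Ctx S B α β) {x : E n} (hx : IsIntPt x) (hlt : ∀ i, α i x < β i + 1) : x ∈ S := by
  rw [h.hS]
  refine ⟨hx, fun i => ?_⟩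
  obtain ⟨k, hk⟩ := h.hα i x hx
  have := hlt i
  rw [hk] at this ⊢
  have h2 : k < β i + 1 := by exact_mod_cast this
  have h3 : k ≤ β i := by omega
  exact_mod_cast h3

lemma Ctx.line {n m : ℕ} {S B : Set (E n)} {α : Fin m → (E n →L[ℝ] ℝ)} {β : Fin m → ℤ}
    (h : Ctx S B α β) {w : E n}
    (hw : ∀ t ε : ℝ, 0 < ε → ∃ z v : E n, IsIntPt z ∧ v ∈ recCone B ∧
      ‖z - t • w - v‖ < ε ∧ ∀ i, α i z < 1) :
    w ∈ recCone B ∧ -w ∈ recCone B := by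
  let U : Set (E n) := {x | ∃ t : ℝ, x + t • w ∈ interior B}
  have hUo : IsOpen U := by
    have : U = ⋃ t : ℝ, (fun x => x + t • w) ⁻¹' interior B := by
      ext x; simp [U]
    rw [this]
    exact isOpen_iUnion fun t => isOpen_interior.preimage (by fun_prop)
  have hUc : Convex ℝ U := by
    rintro x ⟨t, ht⟩ y ⟨t', ht'⟩ a b ha hb hab
    refine ⟨a * t + b * t', ?_⟩
    have := h.hB.1.interior ht ht' ha hb hab
    convert this using 1
    module
  have hsub : U ⊆ B := by
    apply h.hB.absorb h.hne hUo hUc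
    · intro x hx
      exact ⟨0, by simpa using hx⟩
    · rintro s ⟨t, hst⟩ hsS
      obtain ⟨ε, hε, hball⟩ := Metric.isOpen_iff.1 isOpen_interior _ hst
      obtain ⟨z, v, hz, hv, hlt, hα⟩ := hw t ε hε
      have hs := (h.hS s).1 hsS
      have h1 : s + z ∈ interior B := by
        have h2 : (s + t • w) + (z - t • w - v) ∈ interior B := hball (by simpa using hlt)
        have h3 := recCone_interior hv h2
        convert h3 using 1
        abel
      refine h.hB.2.1 _ h1 (h.mem_of_lt (isIntPt_add hs.1 hz) fun i => ?_)
      rw [map_add]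
      linarith [hs.2 i, hα i]
  have key : ∀ t : ℝ, ∀ x ∈ B, x + t • w ∈ B := by
    intro t x hx
    have hcl : IsClosed {x | x + t • w ∈ B} := h.closed.preimage (by fun_prop)
    have hx' : x ∈ closure (interior B) := by
      rw [h.hB.1.closure_interior_eq_closure_of_nonempty_interior h.hne]
      exact subset_closure hx
    refine closure_minimal ?_ hcl hx'
    intro y hy
    exact hsub ⟨-t, by simpa using hy⟩
  refine ⟨fun x hx t _ => key t x hx, fun x hx t _ => ?_⟩
  have := key (-t) x hx
  simpa using this

/-- Recession directions of `B ∩ P` are lineality directions of `B`. -/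
lemma Ctx.neg_mem {n m : ℕ} {S B : Set (E n)} {α : Fin m → (E n →L[ℝ] ℝ)} {β : Fin m → ℤ}
    (h : Ctx S B α β) {r : E n} (hr : r ∈ recCone B) (hα : ∀ i, α i r ≤ 0) :
    -r ∈ recCone B := by
  refine (h.line (w := r) ?_).2
  intro t ε hε
  obtain ⟨δ, hδ, hsm⟩ := exists_small α one_pos
  obtain ⟨T, hT, hT0, z, hz, hzr⟩ := dirichlet r (lt_min hε hδ) t
  refine ⟨z, (T - t) • r, hz, recCone_smul hr (by linarith), ?_, fun i => ?_⟩
  · have : z - t • r - (T - t) • r = z - T • r := by module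
    rw [this]
    exact hzr.trans_le (min_le_left _ _)
  · have h1 := (abs_lt.1 (hsm _ (hzr.trans_le (min_le_right _ _)) i)).2
    rw [map_sub, map_smul, smul_eq_mul] at h1
    have := mul_nonneg hT0 (neg_nonneg.2 (hα i))
    linarith

/-- The structure of the lineality directions. -/
lemma Ctx.linealityData {n m : ℕ} {S B : Set (E n)} {α : Fin m → (E n →L[ℝ] ℝ)} {β : Fin m → ℤ}
    (h : Ctx S B α β) : ∃ (V : Submodule ℝ (E n)) (I : Set (Fin m)) (r₀ : E n),
      (∀ v ∈ V, v ∈ recCone B) ∧ (∀ i ∈ I, ∀ v ∈ V, α i v = 0) ∧ r₀ ∈ V ∧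
      (∀ i, i ∉ I → α i r₀ < 0) ∧
      (∀ w ∈ recCone B, (∀ i ∈ I, α i w ≤ 0) → w ∈ V) := by
  classical
  let R : Set (E n) := {r | r ∈ recCone B ∧ ∀ i, α i r ≤ 0}
  let I : Set (Fin m) := {i | ∀ r ∈ R, α i r = 0}
  have hex : ∀ i, ∃ r ∈ R, i ∉ I → α i r < 0 := by
    intro i
    by_cases hi : i ∈ I
    · exact ⟨0, ⟨recCone_zero, by simp⟩, fun hh => absurd hi hh⟩
    · have : ∃ r ∈ R, α i r ≠ 0 := by
        by_contra! hh
        exact hi hh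
      obtain ⟨r, hr, hne⟩ := this
      exact ⟨r, hr, fun _ => lt_of_le_of_ne (hr.2 i) hne⟩
  choose ρ hρ hρ' using hex
  have hsum : ∀ s : Finset (Fin m), ∑ i ∈ s, ρ i ∈ R := by
    intro s
    refine ⟨?_, fun i => ?_⟩
    · induction s using Finset.induction_on with
      | empty => simpa using recCone_zero
      | insert a s ha ih =>
        rw [Finset.sum_insert ha]
        exact recCone_add (hρ a).1 ih
    · rw [map_sum]
      exact Finset.sum_nonpos fun j _ => (hρ j).2 i
  have hr0 := hsum Finset.univ
  have hneg : ∀ i, i ∉ I → α i (∑ j, ρ j) < 0 := by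
    intro i hi
    rw [map_sum]
    exact Finset.sum_neg' (fun j _ => (hρ j).2 i) ⟨i, Finset.mem_univ i, hρ' i hi⟩
  refine ⟨Submodule.span ℝ R, I, ∑ j, ρ j, ?_, ?_, Submodule.subset_span hr0, hneg, ?_⟩
  · intro v hv
    have : v ∈ recCone B ∧ -v ∈ recCone B := by
      induction hv using Submodule.span_induction with
      | mem x hx => exact ⟨hx.1, h.neg_mem hx.1 hx.2⟩
      | zero => simpa using recCone_zero
      | add x y _ _ hx hy =>
        refine ⟨recCone_add hx.1 hy.1, ?_⟩
        rw [neg_add]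
        exact recCone_add hx.2 hy.2
      | smul a x _ hx =>
        rcases le_total 0 a with ha | ha
        · refine ⟨recCone_smul hx.1 ha, ?_⟩
          rw [← smul_neg]
          exact recCone_smul hx.2 ha
        · have ha' : 0 ≤ -a := by linarith
          refine ⟨?_, ?_⟩
          · have := recCone_smul hx.2 ha'
            simpa using this
          · have := recCone_smul hx.1 ha'
            simpa using this
    exact this.1
  · intro i hi v hv
    induction hv using Submodule.span_induction with
    | mem x hx => exact hi x hx
    | zero => simp
    | add x y _ _ hx hy => simp [hx, hy]
    | smul a x _ hx => simp [hx]
  · intro w hw hwI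
    have hM : ∃ M : ℝ, 0 ≤ M ∧ ∀ i, i ∉ I → α i w + M * α i (∑ j, ρ j) ≤ 0 := by
      have hev : ∀ᶠ M : ℝ in Filter.atTop, ∀ i, i ∉ I → α i w + M * α i (∑ j, ρ j) ≤ 0 := by
        rw [Filter.eventually_all]
        intro i
        by_cases hi : i ∈ I
        · simp [hi]
        · filter_upwards [Filter.eventually_ge_atTop (α i w / (-α i (∑ j, ρ j)))] with M hM _
          have := hneg i hi
          rw [div_le_iff₀ (by linarith)] at hM
          linarith
      obtain ⟨M, hM1, hM2⟩ := (hev.and (Filter.eventually_ge_atTop 0)).exists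
      exact ⟨M, hM2, hM1⟩
    obtain ⟨M, hM0, hM⟩ := hM
    have hmem : w + M • ∑ j, ρ j ∈ R := by
      refine ⟨recCone_add hw (recCone_smul hr0.1 hM0), fun i => ?_⟩
      rw [map_add, map_smul, smul_eq_mul]
      by_cases hi : i ∈ I
      · rw [hi _ hr0, mul_zero, add_zero]
        exact hwI i hi
      · exact hM i hi
    have h1 := (Submodule.span ℝ R).sub_mem (Submodule.subset_span hmem)
      ((Submodule.span ℝ R).smul_mem M (Submodule.subset_span hr0))
    simpa using h1

lemma exists_proj {n : ℕ} (V : Submodule ℝ (E n)) : ∃ π : E n →L[ℝ] E n,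
    (∀ x, x - π x ∈ V) ∧ (∀ x ∈ V, π x = 0) := by
  refine ⟨ContinuousLinearMap.id ℝ _ - V.starProjection, fun x => ?_, fun x hx => ?_⟩
  · simp
  · simp [Submodule.starProjection_eq_self_iff.2 hx]

/-- The lattice is discrete modulo the lineality directions. -/
lemma Ctx.finite {n m : ℕ} {S B : Set (E n)} {α : Fin m → (E n →L[ℝ] ℝ)} {β : Fin m → ℤ}
    (h : Ctx S B α β) {V : Submodule ℝ (E n)} {I : Set (Fin m)} {r₀ : E n}
    (hV : ∀ v ∈ V, v ∈ recCone B) (hI : ∀ i ∈ I, ∀ v ∈ V, α i v = 0) (hr₀ : r₀ ∈ V)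
    (hneg : ∀ i, i ∉ I → α i r₀ < 0)
    (hrec : ∀ w ∈ recCone B, (∀ i ∈ I, α i w ≤ 0) → w ∈ V)
    {π : E n →L[ℝ] E n} (hπ : ∀ x, x - π x ∈ V) (hπ0 : ∀ x ∈ V, π x = 0)
    {T : Set (E n)} (hT : ∀ z ∈ T, IsIntPt z) {R : ℝ} (hR : ∀ z ∈ T, ‖π z‖ ≤ R) :
    (π '' T).Finite := by
  classical
  by_contra hinf
  have hππ : ∀ x, π (π x) = π x := by
    intro x
    have := hπ0 _ (hπ x)
    rw [map_sub, sub_eq_zero] at this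
    exact this.symm
  have hαπ : ∀ i ∈ I, ∀ x, α i (π x) = α i x := by
    intro i hi x
    have := hI i hi _ (hπ x)
    rw [map_sub, sub_eq_zero] at this
    exact this.symm
  have hsmall : ∀ δ : ℝ, 0 < δ → ∃ z, IsIntPt z ∧ π z ≠ 0 ∧ ‖π z‖ < δ := by
    intro δ hδ
    have hinf' : (π '' T).Infinite := hinf
    let e := hinf'.natEmbedding
    have he : ∀ k, ∃ z ∈ T, π z = (e k : E n) := fun k => (e k).2
    choose y hyT hy using he
    obtain ⟨j, k, hjk, hlt⟩ := exists_close (fun k => π (y k)) (fun k => hR _ (hyT k)) hδ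
    refine ⟨y k - y j, isIntPt_sub (hT _ (hyT k)) (hT _ (hyT j)), ?_, by rw [map_sub]; exact hlt⟩
    rw [map_sub, hy, hy, sub_ne_zero]
    intro heq
    exact hjk.ne' (e.injective (Subtype.ext heq))
  choose z₀ hz₀ hz₀ne hz₀lt using fun k : ℕ => hsmall (1 / ((k:ℝ) + 1)) (by positivity)
  obtain ⟨w, -, φ, hφ, hlim⟩ := tendsto_subseq_of_bounded
    (Metric.isBounded_closedBall (x := (0 : E n)) (r := 1))
    (x := fun k => (‖π (z₀ k)‖)⁻¹ • π (z₀ k))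
    (fun k => by
      have := norm_ne_zero_iff.2 (hz₀ne k)
      simp [norm_smul, this])
  let z : ℕ → E n := fun k => z₀ (φ k)
  have hz : ∀ k, IsIntPt (z k) := fun k => hz₀ _
  have hzne : ∀ k, ‖π (z k)‖ ≠ 0 := fun k => norm_ne_zero_iff.2 (hz₀ne _)
  have hz0 : Filter.Tendsto (fun k => π (z k)) Filter.atTop (nhds 0) := by
    rw [tendsto_zero_iff_norm_tendsto_zero]
    have h1 : Filter.Tendsto (fun k => 1 / (((φ k : ℕ):ℝ) + 1)) Filter.atTop (nhds 0) :=
      tendsto_one_div_add_atTop_nhds_zero_nat.comp hφ.tendsto_atTop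
    exact squeeze_zero (fun k => norm_nonneg _) (fun k => (hz₀lt _).le) h1
  let u : ℕ → E n := fun k => (‖π (z k)‖)⁻¹ • π (z k)
  have hu : Filter.Tendsto u Filter.atTop (nhds w) := hlim
  have hw1 : ‖w‖ = 1 := by
    refine tendsto_nhds_unique hu.norm ?_
    have : (fun k => ‖u k‖) = fun _ => 1 := by
      funext k
      simp [u, norm_smul, hzne k]
    rw [this]
    exact tendsto_const_nhds
  have hπw : π w = w := by
    refine tendsto_nhds_unique ((π.continuous.tendsto w).comp hu) ?_
    have : (fun k => π (u k)) = u := by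
      funext k
      simp [u, hππ]
    change Filter.Tendsto (fun k => π (u k)) _ _
    rw [this]
    exact hu
  have hα0 : ∀ᶠ k in Filter.atTop, ∀ i ∈ I, α i (z k) = 0 := by
    rw [Filter.eventually_all]
    intro i
    by_cases hi : i ∈ I
    · have h1 : Filter.Tendsto (fun k => α i (π (z k))) Filter.atTop (nhds (α i 0)) :=
        ((α i).continuous.tendsto 0).comp hz0
      rw [map_zero] at h1
      have h2 := h1.abs
      rw [abs_zero] at h2
      filter_upwards [h2.eventually (gt_mem_nhds one_pos)] with k hk _
      rw [hαπ i hi] at hk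
      obtain ⟨q, hq⟩ := h.hα i _ (hz k)
      rw [hq] at hk ⊢
      have : |q| < 1 := by exact_mod_cast hk
      have : q = 0 := Int.abs_lt_one_iff.1 this
      simp [this]
    · simp [hi]
  have hαw : ∀ i ∈ I, α i w = 0 := by
    intro i hi
    refine tendsto_nhds_unique (((α i).continuous.tendsto w).comp hu) ?_
    refine tendsto_const_nhds.congr' ?_
    filter_upwards [hα0] with k hk
    simp [u, hαπ i hi, hk i hi]
  have hwrec : w ∈ recCone B := by
    refine (h.line ?_).1
    intro t ε hε
    have hev1 : ∀ᶠ k in Filter.atTop, ‖t • u k - t • w‖ < ε / 3 := by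
      have := (hu.const_smul t).sub_const (t • w)
      rw [sub_self, tendsto_zero_iff_norm_tendsto_zero] at this
      exact this.eventually (gt_mem_nhds (by positivity))
    have hev2 : ∀ᶠ k in Filter.atTop, ‖π (z k)‖ < ε / 3 := by
      rw [tendsto_zero_iff_norm_tendsto_zero] at hz0
      exact hz0.eventually (gt_mem_nhds (by positivity))
    obtain ⟨k, ⟨hk1, hk2⟩, hk3⟩ := ((hev1.and hev2).and hα0).exists
    let q : ℤ := ⌊t / ‖π (z k)‖⌋
    let z₁ : E n := (q : ℝ) • z k
    have hz₁ : IsIntPt z₁ := isIntPt_zsmul q (hz k)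
    have hz₁d : ‖π z₁ - t • u k‖ < ε / 3 := by
      have h0 : 0 < ‖π (z k)‖ := lt_of_le_of_ne (norm_nonneg _) (hzne k).symm
      have e1 : π z₁ - t • u k = ((q:ℝ) - t / ‖π (z k)‖) • π (z k) := by
        simp only [z₁, u, map_smul, sub_smul, smul_smul, div_eq_mul_inv]
      rw [e1, norm_smul, Real.norm_eq_abs]
      have h1 : (q:ℝ) ≤ t / ‖π (z k)‖ := Int.floor_le _
      have h2 : t / ‖π (z k)‖ < q + 1 := Int.lt_floor_add_one _
      have h3 : |(q:ℝ) - t / ‖π (z k)‖| ≤ 1 := by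
        rw [abs_le]; constructor <;> linarith
      calc |(q:ℝ) - t / ‖π (z k)‖| * ‖π (z k)‖ ≤ 1 * ‖π (z k)‖ := by gcongr
        _ < ε / 3 := by linarith
    have hM : ∃ M : ℝ, ∀ T, M ≤ T → ∀ i, i ∉ I → α i z₁ + T * α i r₀ ≤ 0 := by
      have hev : ∀ᶠ M : ℝ in Filter.atTop, ∀ i, i ∉ I → α i z₁ + M * α i r₀ ≤ 0 := by
        rw [Filter.eventually_all]
        intro i
        by_cases hi : i ∈ I
        · simp [hi]
        · filter_upwards [Filter.eventually_ge_atTop (α i z₁ / (-α i r₀))] with M hM _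
          have := hneg i hi
          rw [div_le_iff₀ (by linarith)] at hM
          linarith
      exact Filter.eventually_atTop.1 hev
    obtain ⟨M, hM⟩ := hM
    obtain ⟨δ, hδ, hsm⟩ := exists_small α one_pos
    obtain ⟨T', hT', hT0, z', hz', hzr⟩ :=
      dirichlet r₀ (lt_min (show 0 < ε / 3 by positivity) hδ) M
    refine ⟨z₁ + z', (z₁ - π z₁) + T' • r₀, isIntPt_add hz₁ hz',
      hV _ (V.add_mem (hπ z₁) (V.smul_mem _ hr₀)), ?_, fun i => ?_⟩
    · have e : z₁ + z' - t • w - ((z₁ - π z₁) + T' • r₀)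
          = (π z₁ - t • u k) + (t • u k - t • w) + (z' - T' • r₀) := by abel
      rw [e]
      have h3 := hzr.trans_le (min_le_left _ _)
      calc _ ≤ ‖π z₁ - t • u k‖ + ‖t • u k - t • w‖ + ‖z' - T' • r₀‖ := norm_add₃_le
        _ < ε := by linarith
    · have h1 := (abs_lt.1 (hsm _ (hzr.trans_le (min_le_right _ _)) i)).2
      rw [map_sub, map_smul, smul_eq_mul] at h1
      rw [map_add]
      by_cases hi : i ∈ I
      · have h2 : α i z₁ = 0 := by simp [z₁, hk3 i hi]
        rw [hI i hi _ hr₀] at h1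
        linarith
      · have := hM T' hT' i hi
        linarith
  have hwV : w ∈ V := hrec w hwrec fun i hi => (hαw i hi).le
  have : w = 0 := by rw [← hπw]; exact hπ0 w hwV
  rw [this, norm_zero] at hw1
  exact zero_ne_one hw1

/-- Boundedness modulo the lineality directions. -/
lemma Ctx.bounded {n m : ℕ} {S B : Set (E n)} {α : Fin m → (E n →L[ℝ] ℝ)} {β : Fin m → ℤ}
    (h : Ctx S B α β) {V : Submodule ℝ (E n)} {I : Set (Fin m)}
    (hV : ∀ v ∈ V, v ∈ recCone B) (hI : ∀ i ∈ I, ∀ v ∈ V, α i v = 0)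
    (hrec : ∀ w ∈ recCone B, (∀ i ∈ I, α i w ≤ 0) → w ∈ V)
    {π : E n →L[ℝ] E n} (hπ : ∀ x, x - π x ∈ V) (hπ0 : ∀ x ∈ V, π x = 0)
    (γ : ℝ) : ∃ R : ℝ, ∀ b ∈ B, (∀ i, α i b ≤ γ) → ‖π b‖ ≤ R := by
  by_contra! hcon
  choose b hbB hbα hbn using fun k : ℕ => hcon ((k:ℝ) + 1)
  have hππ : ∀ x, π (π x) = π x := by
    intro x
    have := hπ0 _ (hπ x)
    rw [map_sub, sub_eq_zero] at this
    exact this.symm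
  have hαπ : ∀ i ∈ I, ∀ x, α i (π x) = α i x := by
    intro i hi x
    have := hI i hi _ (hπ x)
    rw [map_sub, sub_eq_zero] at this
    exact this.symm
  have hpos : ∀ k, 0 < ‖π (b k)‖ := fun k => lt_trans (by positivity) (hbn k)
  have hπB : ∀ k, π (b k) ∈ B := by
    intro k
    have := hV _ (V.neg_mem (hπ (b k))) (b k) (hbB k) 1 zero_le_one
    simpa using this
  obtain ⟨w, -, φ, hφ, hlim⟩ := tendsto_subseq_of_bounded
    (Metric.isBounded_closedBall (x := (0 : E n)) (r := 1))
    (x := fun k => (‖π (b k)‖)⁻¹ • π (b k))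
    (fun k => by
      have := (hpos k).ne'
      simp [norm_smul, this])
  have hc0' : Filter.Tendsto (fun k => (‖π (b k)‖)⁻¹) Filter.atTop (nhds 0) := by
    refine squeeze_zero (fun k => by positivity) (fun k => ?_)
      tendsto_one_div_add_atTop_nhds_zero_nat
    rw [← one_div]
    exact one_div_le_one_div_of_le (by positivity) (hbn k).le
  have hc0 := hc0'.comp hφ.tendsto_atTop
  have hwrec : w ∈ recCone B := recCone_of_tendsto h.hB.1 h.closed
    (b := fun k => π (b (φ k))) (fun k => hπB _) (c := fun k => (‖π (b (φ k))‖)⁻¹)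
    (fun k => inv_pos.2 (hpos _)) hc0 hlim
  have hw1 : ‖w‖ = 1 := by
    refine tendsto_nhds_unique hlim.norm ?_
    refine tendsto_const_nhds.congr fun k => ?_
    simp [norm_smul, (hpos (φ k)).ne']
  have hπw : π w = w := by
    refine tendsto_nhds_unique ((π.continuous.tendsto w).comp hlim) ?_
    refine hlim.congr fun k => ?_
    simp [hππ]
  have hαw : ∀ i ∈ I, α i w ≤ 0 := by
    intro i hi
    have h1 := ((α i).continuous.tendsto w).comp hlim
    have h2 : Filter.Tendsto (fun k => (‖π (b (φ k))‖)⁻¹ * γ) Filter.atTop (nhds (0 * γ)) :=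
      hc0.mul_const γ
    rw [zero_mul] at h2
    refine le_of_tendsto_of_tendsto' h1 h2 fun k => ?_
    simp only [Function.comp, map_smul, smul_eq_mul, hαπ i hi]
    exact mul_le_mul_of_nonneg_left (hbα _ i) (inv_nonneg.2 (norm_nonneg _))
  have hwV : w ∈ V := hrec w hwrec hαw
  have : w = 0 := by rw [← hπw]; exact hπ0 w hwV
  rw [this, norm_zero] at hw1
  exact zero_ne_one hw1

/-- The open cap `conv (int B ∪ {y})` without its apex. -/
def cap {n : ℕ} (B : Set (E n)) (y : E n) : Set (E n) :=
  {u | ∃ θ : ℝ, 0 ≤ θ ∧ θ < 1 ∧ ∃ b ∈ interior B, u = (1 - θ) • b + θ • y}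

lemma cap_isOpen {n : ℕ} (B : Set (E n)) (y : E n) : IsOpen (cap B y) := by
  rw [isOpen_iff_mem_nhds]
  rintro u ⟨θ, h0, h1, b, hb, rfl⟩
  have h1' : (1 - θ) ≠ 0 := by linarith
  have hc : Continuous (fun u : E n => (1 - θ)⁻¹ • (u - θ • y)) := by fun_prop
  have ho := isOpen_interior (s := B) |>.preimage hc
  refine Filter.mem_of_superset (ho.mem_nhds ?_) ?_
  · simpa [smul_smul, inv_mul_cancel₀ h1'] using hb
  · intro v hv
    refine ⟨θ, h0, h1, _, hv, ?_⟩
    rw [smul_smul, mul_inv_cancel₀ h1']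
    module

lemma smul_comb_div {n : ℕ} {d : ℝ} (hd : d ≠ 0) (p q : ℝ) (b b' : E n) :
    d • ((p / d) • b + (q / d) • b') = p • b + q • b' := by
  rw [smul_add, smul_smul, smul_smul, mul_div_cancel₀ _ hd, mul_div_cancel₀ _ hd]

lemma smul_add_inv {n : ℕ} {d : ℝ} (hd : d ≠ 0) (b v : E n) :
    d • (b + d⁻¹ • v) = d • b + v := by
  rw [smul_add, smul_smul, mul_inv_cancel₀ hd, one_smul]

lemma cap_convex {n : ℕ} {B : Set (E n)} (hB : Convex ℝ B) (y : E n) : Convex ℝ (cap B y) := by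
  rintro _ ⟨θ, h0, h1, b, hb, rfl⟩ _ ⟨θ', h0', h1', b', hb', rfl⟩ p q hp hq hpq
  have hlt : 0 < p * (1 - θ) + q * (1 - θ') := by
    rcases hp.eq_or_lt with rfl | hp'
    · have : q = 1 := by linarith
      subst this
      linarith
    · have h2 : 0 < p * (1 - θ) := mul_pos hp' (by linarith)
      have h3 : 0 ≤ q * (1 - θ') := mul_nonneg hq (by linarith)
      linarith
  have hsum : p * θ + q * θ' = 1 - (p * (1 - θ) + q * (1 - θ')) := by
    linear_combination hpq
  refine ⟨p * θ + q * θ', by positivity, by linarith,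
    (p * (1 - θ) / (p * (1 - θ) + q * (1 - θ'))) • b +
    (q * (1 - θ') / (p * (1 - θ) + q * (1 - θ'))) • b', ?_, ?_⟩
  · refine hB.interior hb hb' ?_ ?_ ?_
    · exact div_nonneg (mul_nonneg hp (by linarith)) hlt.le
    · exact div_nonneg (mul_nonneg hq (by linarith)) hlt.le
    · rw [← add_div, div_self hlt.ne']
  · have e : 1 - (p * θ + q * θ') = p * (1 - θ) + q * (1 - θ') := by rw [hsum]; ring
    rw [e, smul_comb_div hlt.ne']
    module

/-- Key lemma: near every boundary point there is a blocking point of `S`. -/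
lemma Ctx.key {n m : ℕ} {S B : Set (E n)} {α : Fin m → (E n →L[ℝ] ℝ)} {β : Fin m → ℤ}
    (h : Ctx S B α β) {b₀ x : E n} (hb₀ : b₀ ∈ interior B) (hx : x ∈ B) (hx' : x ∉ interior B) :
    ∃ s ∈ S, s ∈ B ∧ ∀ f : E n →L[ℝ] ℝ, f ≠ 0 → (∀ u ∈ B, f u ≤ f s) → f x = f s := by
  obtain ⟨V, I, r₀, hV, hI, hr₀, hneg, hrec⟩ := h.linealityData
  obtain ⟨π, hπ, hπ0⟩ := exists_proj V
  let c : ℕ → ℝ := fun k => 1 / ((k:ℝ) + 1)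
  have hc : ∀ k, 0 < c k := fun k => by simp only [c]; positivity
  have hc0 : Filter.Tendsto c Filter.atTop (nhds 0) := tendsto_one_div_add_atTop_nhds_zero_nat
  have hcanti : Antitone c := by
    intro j k hjk
    simp only [c]
    gcongr
  let y : ℕ → E n := fun k => x + c k • (x - b₀)
  have hy : ∀ k, y k ∉ B := fun k hk => hx' (int_of_extend h.hB.1 hb₀ (hc k) hk)
  have hex : ∀ k, ∃ s ∈ S, s ∈ cap B (y k) := by
    intro k
    by_contra! hcon
    have hsub : cap B (y k) ⊆ B := h.hB.absorb h.hne (cap_isOpen B _) (cap_convex h.hB.1 _)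
      (fun b hb => ⟨0, le_rfl, one_pos, b, hb, by simp⟩) (fun u hu hS => hcon u hS hu)
    apply hy k
    have hlim : Filter.Tendsto (fun j => c (j + 1) • b₀ + (1 - c (j + 1)) • y k) Filter.atTop
        (nhds ((0:ℝ) • b₀ + (1 - 0 : ℝ) • y k)) := by
      have hc1 := hc0.comp (Filter.tendsto_add_atTop_nat 1)
      exact (hc1.smul_const b₀).add ((tendsto_const_nhds.sub hc1).smul_const (y k))
    have e : (0:ℝ) • b₀ + (1 - 0 : ℝ) • y k = y k := by simp
    rw [e] at hlim
    refine h.closed.mem_of_tendsto hlim (Filter.Eventually.of_forall fun j => hsub ?_)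
    have hc1 : c (j + 1) ≤ 1 := by
      have := hcanti (Nat.zero_le (j + 1))
      simpa [c] using this
    have := hc (j + 1)
    exact ⟨1 - c (j + 1), by linarith, by linarith, b₀, hb₀, by simp⟩
  have hanti : ∀ j k, j ≤ k → cap B (y k) ⊆ cap B (y j) := by
    rintro j k hjk _ ⟨θ, h0, h1, b, hb, rfl⟩
    have hcj := hc j
    have hck := hc k
    have hle := hcanti hjk
    set μ := (1 + c k) / (1 + c j) with hμ
    have hμ0 : 0 ≤ μ := by positivity
    have hμ1 : μ ≤ 1 := by rw [hμ, div_le_one (by linarith)]; linarith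
    have hyk : y k = (1 - μ) • b₀ + μ • y j := by
      have h2 : μ * (1 + c j) = 1 + c k := by rw [hμ]; field_simp
      ext i
      simp only [y, PiLp.add_apply, PiLp.smul_apply, PiLp.sub_apply, smul_eq_mul]
      linear_combination (b₀ i - x i) * h2
    have hθμ : θ * μ < 1 := by nlinarith
    refine ⟨θ * μ, by positivity, hθμ,
      ((1 - θ) / (1 - θ * μ)) • b + (θ * (1 - μ) / (1 - θ * μ)) • b₀, ?_, ?_⟩
    · refine h.hB.1.interior hb hb₀ ?_ ?_ ?_
      · exact div_nonneg (by linarith) (by linarith)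
      · exact div_nonneg (mul_nonneg h0 (by linarith)) (by linarith)
      · rw [← add_div, div_eq_one_iff_eq (by linarith)]
        ring
    · have h3 : 1 - θ * μ ≠ 0 := by linarith
      rw [hyk, smul_comb_div h3]
      module
  choose s hsS hscap using hex
  have hinv : ∀ k, ∀ u ∈ cap B (y k), ∀ v ∈ V, u + v ∈ cap B (y k) := by
    rintro k _ ⟨θ, h0, h1, b, hb, rfl⟩ v hv
    have h3 : 1 - θ ≠ 0 := by linarith
    refine ⟨θ, h0, h1, b + (1 - θ)⁻¹ • v, recCone_interior (hV _ (V.smul_mem _ hv)) hb, ?_⟩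
    rw [smul_add_inv h3]
    abel
  obtain ⟨R, hR⟩ := h.bounded hV hI hrec hπ hπ0 (∑ i, (|(β i : ℝ)| + |α i (y 0 - b₀)|))
  have hbd : ∀ u ∈ S ∩ cap B (y 0), ‖π u‖ ≤ R + ‖π (y 0 - b₀)‖ := by
    rintro u ⟨huS, θ, h0, h1, b, hb, hu⟩
    have hb' : (1 - θ) • b + θ • b₀ ∈ B :=
      h.hB.1 (interior_subset hb) (interior_subset hb₀) (by linarith) h0 (by ring)
    have hub : u = ((1 - θ) • b + θ • b₀) + θ • (y 0 - b₀) := by rw [hu]; module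
    have h2 := hR _ hb' (fun i => by
      have h4 : α i ((1 - θ) • b + θ • b₀) = α i u - θ * α i (y 0 - b₀) := by
        rw [hub, map_add _ _ (θ • (y 0 - b₀)), map_smul _ θ (y 0 - b₀), smul_eq_mul]; ring
      rw [h4]
      have h5 := ((h.hS u).1 huS).2 i
      have h6 : |(β i : ℝ)| + |α i (y 0 - b₀)| ≤ ∑ i, (|(β i : ℝ)| + |α i (y 0 - b₀)|) :=
        Finset.single_le_sum (f := fun i => |(β i : ℝ)| + |α i (y 0 - b₀)|)
          (fun j _ => by positivity) (Finset.mem_univ i)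
      have h7 := le_abs_self (β i : ℝ)
      have h8 : -(θ * α i (y 0 - b₀)) ≤ |α i (y 0 - b₀)| := by
        calc -(θ * α i (y 0 - b₀)) ≤ |θ * α i (y 0 - b₀)| := neg_le_abs _
          _ = θ * |α i (y 0 - b₀)| := by rw [abs_mul, abs_of_nonneg h0]
          _ ≤ 1 * |α i (y 0 - b₀)| := by gcongr
          _ = _ := one_mul _
      linarith)
    rw [hub, map_add _ _ (θ • (y 0 - b₀)), map_smul _ θ (y 0 - b₀)]
    have h9 : ‖θ • π (y 0 - b₀)‖ ≤ ‖π (y 0 - b₀)‖ := by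
      rw [norm_smul, Real.norm_of_nonneg h0]
      exact mul_le_of_le_one_left (norm_nonneg _) h1.le
    exact (norm_add_le _ _).trans (add_le_add h2 h9)
  have hfin := h.finite hV hI hr₀ hneg hrec hπ hπ0 (T := S ∩ cap B (y 0))
    (fun z hz => ((h.hS z).1 hz.1).1) hbd
  have hmem : ∀ k, π (s k) ∈ π '' (S ∩ cap B (y 0)) := fun k =>
    ⟨s k, ⟨hsS k, hanti 0 k (Nat.zero_le k) (hscap k)⟩, rfl⟩
  have : Finite (π '' (S ∩ cap B (y 0))) := hfin
  obtain ⟨p, hp⟩ := Finite.exists_infinite_fiber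
    (fun k => (⟨π (s k), hmem k⟩ : (π '' (S ∩ cap B (y 0)) : Set (E n))))
  have hpinf := Set.infinite_coe_iff.1 hp
  obtain ⟨k₀, hk₀⟩ := hpinf.nonempty
  have hall : ∀ k, s k₀ ∈ cap B (y k) := by
    intro k
    obtain ⟨j, hj, hkj⟩ := hpinf.exists_gt k
    have heq : π (s j) = π (s k₀) := by
      have h1 : (⟨π (s j), hmem j⟩ : (π '' (S ∩ cap B (y 0)) : Set (E n))) = p := hj
      have h2 : (⟨π (s k₀), hmem k₀⟩ : (π '' (S ∩ cap B (y 0)) : Set (E n))) = p := hk₀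
      exact congrArg Subtype.val (h1.trans h2.symm)
    have hv : s k₀ - s j ∈ V := by
      have := V.sub_mem (hπ (s k₀)) (hπ (s j))
      rw [heq] at this
      simpa using this
    have := hinv j _ (hscap j) _ hv
    rw [add_sub_cancel] at this
    exact hanti k j hkj.le this
  have hylim : Filter.Tendsto y Filter.atTop (nhds x) := by
    have := (hc0.smul_const (x - b₀)).const_add x
    simpa using this
  have hsB : s k₀ ∈ B := by
    choose θ h0 h1 b hb heq using hall
    have hlim : Filter.Tendsto (fun k => s k₀ - θ k • (y k - x)) Filter.atTop
        (nhds (s k₀ - 0)) := by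
      refine tendsto_const_nhds.sub ?_
      rw [tendsto_zero_iff_norm_tendsto_zero]
      have h2 : Filter.Tendsto (fun k => ‖y k - x‖) Filter.atTop (nhds 0) := by
        have := (hylim.sub_const x).norm
        simpa using this
      refine squeeze_zero (fun k => norm_nonneg _) (fun k => ?_) h2
      rw [norm_smul, Real.norm_of_nonneg (h0 k)]
      exact mul_le_of_le_one_left (norm_nonneg _) (h1 k).le
    rw [sub_zero] at hlim
    refine h.closed.mem_of_tendsto hlim (Filter.Eventually.of_forall fun k => ?_)
    have e : s k₀ - θ k • (y k - x) = (1 - θ k) • b k + θ k • x := by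
      conv_lhs => rw [heq k]
      module
    rw [e]
    exact h.hB.1 (interior_subset (hb k)) hx (by linarith [h1 k]) (h0 k) (by ring)
  refine ⟨s k₀, hsS k₀, hsB, fun f hf hle => le_antisymm (hle x hx) ?_⟩
  refine ge_of_tendsto ((f.continuous.tendsto x).comp hylim)
    (Filter.Eventually.of_forall fun k => ?_)
  obtain ⟨θ, h0, h1, b, hb, heq⟩ := hall k
  have hlt := lt_of_mem_interior hf hle hb
  have he : f (s k₀) = (1 - θ) * f b + θ * f (y k) := by
    conv_lhs => rw [heq]
    simp
  change f (s k₀) ≤ f (y k)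
  by_contra! hcon
  nlinarith

/-- Clearing denominators. -/
lemma exists_denom {n : ℕ} {a : E n} (ha : IsRatVec a) :
    ∃ N : ℝ, 0 < N ∧ ∀ j, ∃ k : ℤ, N * a j = k := by
  choose q hq using ha
  refine ⟨((∏ j, (q j).den : ℕ) : ℝ), ?_, fun j => ?_⟩
  · exact_mod_cast Finset.prod_pos fun j _ => (q j).den_pos
  · obtain ⟨c, hc⟩ := Finset.dvd_prod_of_mem (fun j => (q j).den) (Finset.mem_univ j)
    refine ⟨c * (q j).num, ?_⟩
    rw [hc, hq]
    have h1 : ((q j : ℚ) : ℝ) * ((q j).den : ℝ) = (q j).num := by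
      exact_mod_cast Rat.mul_den_eq_num (q j)
    push_cast
    rw [← h1]
    ring

lemma exists_integral_system {n : ℕ} {S : Set (E n)} (hS : IsIntPtsOfRatPolyhedron S) :
    ∃ (m : ℕ) (α : Fin m → (E n →L[ℝ] ℝ)) (β : Fin m → ℤ),
      (∀ x, x ∈ S ↔ IsIntPt x ∧ ∀ i, α i x ≤ β i) ∧
      (∀ i z, IsIntPt z → ∃ k : ℤ, α i z = k) := by
  obtain ⟨m, A, b, hA, -, rfl⟩ := hS
  choose N hN hNk using fun i => exists_denom (hA i)
  let α : Fin m → (E n →L[ℝ] ℝ) := fun i => N i • innerSL ℝ (A i)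
  have hα : ∀ i x, α i x = N i * dot (A i) x := by
    intro i x
    simp [α, dot, PiLp.inner_apply, mul_comm]
  have hint : ∀ i z, IsIntPt z → ∃ k : ℤ, α i z = k := by
    intro i z hz
    choose k hk using hz
    choose l hl using hNk i
    refine ⟨∑ j, l j * k j, ?_⟩
    rw [hα, dot, Finset.mul_sum]
    push_cast
    refine Finset.sum_congr rfl fun j _ => ?_
    rw [← mul_assoc, hl, hk]
  refine ⟨m, α, fun i => ⌊N i * b i⌋, fun x => ?_, hint⟩
  simp only [Set.mem_ofPred_eq]
  refine and_congr_right fun hx => forall_congr' fun i => ?_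
  obtain ⟨k, hk⟩ := hint i x hx
  rw [hk]
  have h1 : (k : ℝ) ≤ ⌊N i * b i⌋ ↔ k ≤ ⌊N i * b i⌋ := by norm_cast
  rw [h1, Int.le_floor, ← hk, hα, mul_le_mul_iff_right₀ (hN i)]

lemma sdim_of_interior {n : ℕ} {M : Set (E n)} (h : (interior M).Nonempty) : sdim M = n := by
  have : affineSpan ℝ M = ⊤ := by
    rw [eq_top_iff, ← isOpen_interior.affineSpan_eq_top h]
    exact affineSpan_mono ℝ interior_subset
  rw [sdim, this, AffineSubspace.direction_top, finrank_top]
  simp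

/-- Points of the intrinsic interior can be pushed away from any point of the affine span. -/
lemma intrinsic_extend {n : ℕ} {F : Set (E n)} {x u : E n} (hx : x ∈ intrinsicInterior ℝ F)
    (hu : u ∈ affineSpan ℝ F) : ∃ η : ℝ, 0 < η ∧ x + η • (x - u) ∈ F := by
  obtain ⟨x', hx', rfl⟩ := hx
  have hmem : ∀ t : ℝ, (x' : E n) + t • ((x' : E n) - u) ∈ affineSpan ℝ F := by
    intro t
    have h1 : (x' : E n) -ᵥ u ∈ (affineSpan ℝ F).direction :=
      AffineSubspace.vsub_mem_direction x'.2 hu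
    have h2 := AffineSubspace.vadd_mem_of_mem_direction
      ((affineSpan ℝ F).direction.smul_mem t h1) x'.2
    simpa [add_comm] using h2
  let g : ℝ → affineSpan ℝ F := fun t => ⟨(x' : E n) + t • ((x' : E n) - u), hmem t⟩
  have hg : Continuous g := by
    apply Continuous.subtype_mk
    fun_prop
  have hg0 : g 0 = x' := by
    apply Subtype.ext
    simp [g]
  have hn := (isOpen_interior.preimage hg).mem_nhds
    (show (0:ℝ) ∈ g ⁻¹' interior _ by rw [Set.mem_preimage, hg0]; exact hx')
  obtain ⟨δ, hδ, hb⟩ := Metric.mem_nhds_iff.1 hn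
  refine ⟨δ / 2, by positivity, ?_⟩
  have h3 := hb (show δ / 2 ∈ Metric.ball (0:ℝ) δ by
    rw [Metric.mem_ball, Real.dist_eq, sub_zero, abs_of_pos (by positivity)]; linarith)
  have h4 : g (δ / 2) ∈ interior (Subtype.val ⁻¹' F) := h3
  have h5 := interior_subset h4
  rw [Set.mem_preimage] at h5
  exact h5

/-- For every maximal S-free convex set B with int(B ∩ conv S) ≠ ∅ there is a
maximal lattice-free convex set K such that F ∩ K is a facet of K for every
facet F of B. -/
theorem stmt_9 {n : ℕ} (S : Set (E n)) (hS : IsIntPtsOfRatPolyhedron S)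
    (hdim : FullDimSet S) (B : Set (E n)) (hB : MaxSFree S B)
    (hne : (interior (B ∩ convexHull ℝ S)).Nonempty) :
    ∃ K : Set (E n), MaxLatticeFree K ∧
      ∀ F : Set (E n), IsFacetOf F B → IsFacetOf (F ∩ K) K := by
  obtain ⟨m, α, β, hSα, hα⟩ := exists_integral_system hS
  let P : Set (E n) := {x | ∀ i, α i x ≤ β i + 1 / 2}
  have hPc : Convex ℝ P := by
    intro x hx y hy a b ha hb hab i
    rw [map_add, map_smul, map_smul, smul_eq_mul, smul_eq_mul]
    have h1 := mul_le_mul_of_nonneg_left (hx i) ha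
    have h2 := mul_le_mul_of_nonneg_left (hy i) hb
    have h3 : a * ((β i : ℝ) + 1 / 2) + b * (β i + 1 / 2) = β i + 1 / 2 := by
      rw [← add_mul, hab, one_mul]
    linarith
  have hSP : convexHull ℝ S ⊆ P := by
    refine convexHull_min (fun s hs i => ?_) hPc
    have := ((hSα s).1 hs).2 i
    linarith
  have hneC : (interior (B ∩ P)).Nonempty :=
    hne.mono (interior_mono (Set.inter_subset_inter_right B hSP))
  have hneB : (interior B).Nonempty := hneC.mono (interior_mono Set.inter_subset_left)
  have hctx : Ctx S B α β := ⟨hSα, hα, hB, hneB⟩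
  have hCfree : LatticeFree (B ∩ P) := by
    intro z hz hint
    refine hB.2.1 z (interior_mono Set.inter_subset_left hz) (hctx.mem_of_lt hint fun i => ?_)
    have := (interior_subset hz).2 i
    linarith
  obtain ⟨K, hK, hCK⟩ := exists_maxLatticeFree (hB.1.inter hPc) hCfree hneC
  have hneK : (interior K).Nonempty := hneC.mono (interior_mono hCK)
  -- near a point of `S ∩ B`, the set `K` contains `B`
  have hloc : ∀ s ∈ S, s ∈ B → ∀ u ∈ B, ∃ τ : ℝ, 0 < τ ∧ τ < 1 ∧ s + τ • (u - s) ∈ B ∧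
      s + τ • (u - s) ∈ K := by
    intro s hs hsB u hu
    obtain ⟨δ, hδ, hsm⟩ := exists_small α (show (0:ℝ) < 1 / 2 by norm_num)
    obtain ⟨τ, h0, h1, hτ⟩ := extend_mem (Metric.isOpen_ball (x := (0 : E n)) (ε := δ))
      (Metric.mem_ball_self hδ) (u - s)
    have h2 := hτ τ h0.le le_rfl
    rw [zero_add, mem_ball_zero_iff] at h2
    have hmB : s + τ • (u - s) ∈ B := hB.1.add_smul_sub_mem hsB hu ⟨h0.le, h1.le⟩
    refine ⟨τ, h0, h1, hmB, hCK ⟨hmB, fun i => ?_⟩⟩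
    have h3 := (abs_lt.1 (hsm _ h2 i)).2
    have h4 := ((hSα s).1 hs).2 i
    rw [map_add]
    linarith
  have hSK : ∀ s ∈ S, s ∈ B → s ∈ K := fun s hs hsB => hCK ⟨hsB, fun i => by
    have := ((hSα s).1 hs).2 i
    linarith⟩
  obtain ⟨b₀, hb₀C⟩ := hneC
  have hb₀ : b₀ ∈ interior B := interior_mono Set.inter_subset_left hb₀C
  have hb₀K : b₀ ∈ interior K := interior_mono hCK hb₀C
  have hKB : K ⊆ B := by
    intro y hyK
    by_contra hyB
    -- last point of the segment from `b₀` to `y` in `B`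
    let J : Set ℝ := {t | t ∈ Set.Icc (0:ℝ) 1 ∧ b₀ + t • (y - b₀) ∈ B}
    have hJc : IsCompact J := by
      refine isCompact_Icc.inter_right ?_
      exact hctx.closed.preimage (f := fun t : ℝ => b₀ + t • (y - b₀)) (by fun_prop)
    have hJne : J.Nonempty := ⟨0, by simp, by simpa using interior_subset hb₀⟩
    obtain ⟨τ, hτ⟩ := hJc.exists_isGreatest hJne
    have hτ1 : τ < 1 := by
      refine lt_of_le_of_ne hτ.1.1.2 ?_
      rintro rfl
      exact hyB (by simpa using hτ.1.2)
    have hx' : b₀ + τ • (y - b₀) ∉ interior B := by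
      intro hx
      obtain ⟨η, h0, -, h⟩ := extend_mem isOpen_interior hx (y - b₀)
      have hmin : 0 < min η (1 - τ) := lt_min h0 (by linarith)
      have h2 := interior_subset (h (min η (1 - τ)) hmin.le (min_le_left _ _))
      have h3 : τ + min η (1 - τ) ∈ J := by
        refine ⟨⟨by linarith [hτ.1.1.1], by linarith [min_le_right η (1 - τ)]⟩, ?_⟩
        rw [add_smul, ← add_assoc]
        exact h2
      have := hτ.2 h3
      linarith
    obtain ⟨s, hsS, hsB, hsf⟩ := hctx.key hb₀ hτ.1.2 hx'
    have hsK : s ∉ interior K := fun hh => hK.2.1 s hh ((hSα s).1 hsS).1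
    obtain ⟨f, hf0, hf⟩ := exists_support hK.1 hneK hsK
    have hfB : ∀ u ∈ B, f u ≤ f s := by
      intro u hu
      obtain ⟨t, ht, -, -, htK⟩ := hloc s hsS hsB u hu
      have := hf _ htK
      rw [map_add, map_smul, map_sub, smul_eq_mul] at this
      by_contra! hcon
      have := mul_pos ht (sub_pos.2 hcon)
      linarith
    have h1 := hsf f hf0 hfB
    have h2 := lt_of_mem_interior hf0 hf hb₀K
    have h3 := hf y hyK
    rw [map_add, map_smul, map_sub, smul_eq_mul] at h1
    have h4 : 0 ≤ τ := hτ.1.1.1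
    nlinarith
  refine ⟨K, hK, fun F hF => ?_⟩
  obtain ⟨⟨hFB, hFc, hFface⟩, hFne, hFdim⟩ := hF
  rw [sdim_of_interior hneB] at hFdim
  obtain ⟨x, hx⟩ := hFne.intrinsicInterior hFc
  have hxF : x ∈ F := intrinsicInterior_subset hx
  have hface' : ∀ u ∈ B, ∀ η : ℝ, 0 < η → x + η • (x - u) ∈ B → u ∈ F := by
    intro u hu η hη hm
    refine (hFface u hu _ hm (η / (1 + η)) (by positivity) ?_ ?_).1
    · rw [div_lt_one (by linarith)]; linarith
    · convert hxF using 1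
      ext i
      simp
      field_simp
      ring
  have hx' : x ∉ interior B := by
    intro hxi
    have hBF : B ⊆ F := by
      intro u hu
      obtain ⟨η, h0, -, h⟩ := extend_mem isOpen_interior hxi (x - u)
      exact hface' u hu η h0 (interior_subset (h η h0.le le_rfl))
    have hEq : F = B := hFB.antisymm hBF
    rw [hEq, sdim_of_interior hneB] at hFdim
    omega
  obtain ⟨s, hsS, hsB, hsf⟩ := hctx.key hb₀ (hFB hxF) hx'
  obtain ⟨f, hf0, hf⟩ := exists_support hB.1 hneB (fun hh => hB.2.1 s hh hsS)
  have hfx := hsf f hf0 hf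
  have hfF : ∀ u ∈ F, f u = f s := by
    intro u hu
    refine le_antisymm (hf u (hFB hu)) ?_
    obtain ⟨η, h0, hm⟩ := intrinsic_extend hx (subset_affineSpan ℝ F hu)
    have := hf _ (hFB hm)
    rw [map_add, map_smul, map_sub, smul_eq_mul, hfx] at this
    by_contra! hcon
    have := mul_pos h0 (sub_pos.2 hcon)
    linarith
  have hdir : (affineSpan ℝ F).direction = LinearMap.ker (f : E n →ₗ[ℝ] ℝ) := by
    apply Submodule.eq_of_le_of_finrank_eq
    · rw [direction_affineSpan, vectorSpan_def, Submodule.span_le]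
      rintro _ ⟨u, hu, v, hv, rfl⟩
      simp [hfF u hu, hfF v hv]
    · have h1 := LinearMap.finrank_range_add_finrank_ker (f : E n →ₗ[ℝ] ℝ)
      have h2 : LinearMap.range (f : E n →ₗ[ℝ] ℝ) = ⊤ := by
        rw [LinearMap.range_eq_top]
        apply LinearMap.surjective
        intro hh
        apply hf0
        ext v
        exact LinearMap.congr_fun hh v
      rw [h2, finrank_top, Module.finrank_self, finrank_euclideanSpace_fin] at h1
      unfold sdim at hFdim
      omega
  have hsaff : s ∈ affineSpan ℝ F := by
    have h1 : s - x ∈ (affineSpan ℝ F).direction := by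
      rw [hdir]
      simp [hfx]
    have h2 := AffineSubspace.vadd_mem_of_mem_direction h1 (subset_affineSpan ℝ F hxF)
    simpa using h2
  have hsF : s ∈ F := by
    obtain ⟨η, h0, hm⟩ := intrinsic_extend hx hsaff
    exact hface' s hsB η h0 (hFB hm)
  have hsK : s ∈ K := hSK s hsS hsB
  have hspan : affineSpan ℝ (F ∩ K) = affineSpan ℝ F := by
    apply le_antisymm (affineSpan_mono ℝ Set.inter_subset_left)
    rw [affineSpan_le]
    intro u hu
    obtain ⟨τ, h0, h1, -, hτK⟩ := hloc s hsS hsB u (hFB hu)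
    have hτF : s + τ • (u - s) ∈ F := hFc.add_smul_sub_mem hsF hu ⟨h0.le, h1.le⟩
    have hm1 := subset_affineSpan ℝ (F ∩ K) ⟨hτF, hτK⟩
    have hm2 := subset_affineSpan ℝ (F ∩ K) ⟨hsF, hsK⟩
    have hl := AffineMap.lineMap_mem τ⁻¹ hm2 hm1
    rw [AffineMap.lineMap_apply] at hl
    simpa [smul_smul, inv_mul_cancel₀ h0.ne'] using hl
  refine ⟨⟨Set.inter_subset_right, hFc.inter hK.1, ?_⟩, ⟨s, hsF, hsK⟩, ?_⟩
  · intro u hu v hv t h0 h1 hm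
    have := hFface u (hKB hu) v (hKB hv) t h0 h1 hm.1
    exact ⟨⟨this.1, hu⟩, ⟨this.2, hv⟩⟩
  · rw [sdim_of_interior hneK]
    unfold sdim at hFdim ⊢
    rw [hspan]
    exact hFdim
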